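/- (Decomposition of the Gaussian log-likelihood into volatility and correlation parts.) Let Σ = D R D be an N × N symmetric positive definite real matrix, where D is a diagonal matrix with strictly positive diagonal entries and R is symmetric positive definite with unit diagonal. Then for every x ∈ ℝ^N, with e = D^{-1} x, log det Σ + xᵀ Σ^{-1} x = ( log det(D²) + xᵀ D^{-2} x ) + ( log det R + eᵀ R^{-1} e − eᵀ e ). -/

import Mathlib

open Matrix

/-- **Decomposition of the Gaussian log-likelihood into volatility and
correlation parts.** Let `S = D R D` be symmetric positive definite, with `D`
diagonal with strictly positive diagonal entries and `R` symmetric positive definite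
with unit diagonal.  Then for every `x`, with `e = D⁻¹ x`,
`log det S + xᵀ S⁻¹ x = (log det D² + xᵀ D⁻² x) + (log det R + eᵀ R⁻¹ e − eᵀ e)`. -/
theorem statement16 {N : ℕ}
    (d : Fin N → ℝ) (hd : ∀ i, 0 < d i)
    (R : Matrix (Fin N) (Fin N) ℝ) (hR : R.PosDef) (hRdiag : ∀ i, R i i = 1)
    (S : Matrix (Fin N) (Fin N) ℝ) (hSpd : S.PosDef)
    (hS : S = Matrix.diagonal d * R * Matrix.diagonal d)
    (x : Fin N → ℝ) :
    Real.log S.det + x ⬝ᵥ S⁻¹.mulVec x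
      = (Real.log (Matrix.diagonal d * Matrix.diagonal d).det
            + x ⬝ᵥ ((Matrix.diagonal d * Matrix.diagonal d)⁻¹).mulVec x)
        + (Real.log R.det
            + ((Matrix.diagonal d)⁻¹.mulVec x) ⬝ᵥ R⁻¹.mulVec ((Matrix.diagonal d)⁻¹.mulVec x)
            - ((Matrix.diagonal d)⁻¹.mulVec x) ⬝ᵥ ((Matrix.diagonal d)⁻¹.mulVec x)) := by
  have hdet : (Matrix.diagonal d).det ≠ 0 := by
    rw [Matrix.det_diagonal]
    exact (Finset.prod_pos fun i _ => hd i).ne'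
  have hsymm : ∀ y : Fin N → ℝ,
      x ⬝ᵥ (Matrix.diagonal d)⁻¹.mulVec y = (Matrix.diagonal d)⁻¹.mulVec x ⬝ᵥ y := by
    intro y
    rw [Matrix.dotProduct_mulVec, ← Matrix.mulVec_transpose, Matrix.transpose_nonsing_inv,
      Matrix.diagonal_transpose]
  have hlog : Real.log S.det
      = Real.log (Matrix.diagonal d * Matrix.diagonal d).det + Real.log R.det := by
    rw [← Real.log_mul (by rw [Matrix.det_mul]; exact mul_ne_zero hdet hdet) hR.det_pos.ne', hS]
    simp only [Matrix.det_mul]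
    congr 1
    ring
  rw [hlog, hS]
  simp only [Matrix.mul_inv_rev, ← Matrix.mulVec_mulVec, hsymm]
  ring
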